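/- Let C be a decomposition finite category, B the free ℤ-module on its morphisms with the deconcatenation coproduct Δ, and let N ⊆ B be the ℤ-submodule spanned by all differences f − g with f ∼ g. Then Δ(N) ⊆ B ⊗ N + N ⊗ B; that is, for every x ∈ N, Δ(x) lies in the submodule of B ⊗ B generated by elements b ⊗ n and n ⊗ b with b ∈ B, n ∈ N. Consequently Δ descends to the quotient module B/N. -/

import Mathlib

open CategoryTheory
open scoped TensorProduct

universe v u

variable (C : Type u) [Category.{v} C]

/-- The type of all morphisms of `C`. -/
def Mor := Σ (X : C) (Y : C), X ⟶ Y

/-- The type of factorizations `φ = φ₀ ∘ φ₁` of a morphism. -/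
def Factorizations {X Y : C} (φ : X ⟶ Y) : Type max u v :=
  {p : Σ Z : C, (X ⟶ Z) × (Z ⟶ Y) // p.2.1 ≫ p.2.2 = φ}

/-- A category is decomposition finite if every morphism has only finitely many
factorizations. -/
def DecompositionFinite : Prop :=
  ∀ (X Y : C) (φ : X ⟶ Y), Finite (Factorizations C φ)

/-- The free `ℤ`-module on the set of morphisms of `C`. -/
abbrev MorMod := Mor C →₀ ℤ

/-- The basis element corresponding to a morphism. -/
noncomputable def morGen {X Y : C} (φ : X ⟶ Y) : MorMod C :=
  Finsupp.single ⟨X, Y, φ⟩ 1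

/-- The deconcatenation coproduct: `Δ(φ) = Σ_{φ = φ₀ ∘ φ₁} φ₀ ⊗ φ₁`. -/
noncomputable def coprod : MorMod C →ₗ[ℤ] MorMod C ⊗[ℤ] MorMod C :=
  Finsupp.lift (MorMod C ⊗[ℤ] MorMod C) ℤ (Mor C) fun m =>
    ∑ᶠ p : Factorizations C m.2.2,
      morGen C p.1.2.2 ⊗ₜ[ℤ] morGen C p.1.2.1

/-- Morphisms `f : X ⟶ Y` and `g : X' ⟶ Y'` are equivalent if there are isomorphisms
`σ : X ≅ X'` and `σ' : Y ≅ Y'` with `g ∘ σ = σ' ∘ f`. -/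
def MorEquiv {X Y X' Y' : C} (f : X ⟶ Y) (g : X' ⟶ Y') : Prop :=
  ∃ (σ : X ≅ X') (σ' : Y ≅ Y'), σ.hom ≫ g = f ≫ σ'.hom

/-- The `ℤ`-submodule spanned by the differences `f − g` for equivalent morphisms
`f ∼ g`. -/
noncomputable def equivDiffs : Submodule ℤ (MorMod C) :=
  Submodule.span ℤ
    {x : MorMod C | ∃ (X Y X' Y' : C) (f : X ⟶ Y) (g : X' ⟶ Y'),
      MorEquiv C f g ∧ x = morGen C f - morGen C g}

/-- Transport of factorizations along an equivalence of morphisms. -/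
def factEquiv {X Y X' Y' : C} (f : X ⟶ Y) (g : X' ⟶ Y') (s : X ≅ X') (t : Y ≅ Y')
    (e : s.hom ≫ g = f ≫ t.hom) : Factorizations C f ≃ Factorizations C g where
  toFun p := ⟨⟨p.1.1, s.inv ≫ p.1.2.1, p.1.2.2 ≫ t.hom⟩, by
    have hp := p.2
    simp only [Category.assoc]
    rw [← Category.assoc p.1.2.1, hp, ← e, Iso.inv_hom_id_assoc]⟩
  invFun p := ⟨⟨p.1.1, s.hom ≫ p.1.2.1, p.1.2.2 ≫ t.inv⟩, by
    have hp := p.2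
    simp only [Category.assoc]
    rw [← Category.assoc p.1.2.1, hp, ← Category.assoc, e, Category.assoc, Iso.hom_inv_id,
      Category.comp_id]⟩
  left_inv p := by
    obtain ⟨⟨Z, a, b⟩, hp⟩ := p
    apply Subtype.ext
    simp
  right_inv p := by
    obtain ⟨⟨Z, a, b⟩, hp⟩ := p
    apply Subtype.ext
    simp

lemma coprod_morGen {X Y : C} (f : X ⟶ Y) :
    coprod C (morGen C f) = ∑ᶠ p : Factorizations C f,
      morGen C p.1.2.2 ⊗ₜ[ℤ] morGen C p.1.2.1 := by
  unfold coprod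
  rw [Finsupp.lift_apply]
  conv_lhs => rw [morGen]
  refine (Finsupp.sum_single_index ?_).trans ?_
  · exact zero_smul ℤ _
  · exact one_smul ℤ _

lemma coprod_mem (h : DecompositionFinite C) : ∀ x ∈ equivDiffs C,
      coprod C x ∈
        LinearMap.range (TensorProduct.map (⊤ : Submodule ℤ (MorMod C)).subtype
            (equivDiffs C).subtype)
        ⊔ LinearMap.range (TensorProduct.map (equivDiffs C).subtype
            (⊤ : Submodule ℤ (MorMod C)).subtype) := by
  intro x hx
  refine Submodule.span_induction (p := fun x _ => coprod C x ∈ _) ?_ ?_ ?_ ?_ hx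
  rotate_left
  · rw [map_zero]; exact Submodule.zero_mem _
  · intro a b _ _ ha hb
    rw [map_add]; exact Submodule.add_mem _ ha hb
  · intro n a _ ha
    rw [map_zsmul]; exact zsmul_mem ha n
  rintro _ ⟨X, Y, X', Y', f, g, ⟨s, t, e⟩, rfl⟩
  rw [map_sub, coprod_morGen, coprod_morGen,
    ← finsum_comp_equiv (factEquiv C f g s t e)]
  haveI := h _ _ f
  rw [← finsum_sub_distrib (Set.toFinite _) (Set.toFinite _)]
  refine finsum_induction (· ∈ _) (Submodule.zero_mem _)
    (fun _ _ => Submodule.add_mem _) fun p => ?_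
  obtain ⟨⟨Z, a, b⟩, hp⟩ := p
  change morGen C b ⊗ₜ[ℤ] morGen C a - morGen C (b ≫ t.hom) ⊗ₜ[ℤ] morGen C (s.inv ≫ a) ∈ _
  have ha : morGen C a - morGen C (s.inv ≫ a) ∈ equivDiffs C :=
    Submodule.subset_span ⟨_, _, _, _, _, _, ⟨s, Iso.refl _, by simp⟩, rfl⟩
  have hb : morGen C b - morGen C (b ≫ t.hom) ∈ equivDiffs C :=
    Submodule.subset_span ⟨_, _, _, _, _, _, ⟨Iso.refl _, t, by simp⟩, rfl⟩
  have key : morGen C b ⊗ₜ[ℤ] morGen C a - morGen C (b ≫ t.hom) ⊗ₜ[ℤ] morGen C (s.inv ≫ a)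
      = morGen C b ⊗ₜ[ℤ] (morGen C a - morGen C (s.inv ≫ a))
        + (morGen C b - morGen C (b ≫ t.hom)) ⊗ₜ[ℤ] morGen C (s.inv ≫ a) := by
    rw [TensorProduct.tmul_sub, TensorProduct.sub_tmul]; abel
  rw [key]
  exact Submodule.add_mem_sup
    ⟨(⟨morGen C b, trivial⟩ : (⊤ : Submodule ℤ (MorMod C))) ⊗ₜ[ℤ] ⟨_, ha⟩, rfl⟩
    ⟨⟨_, hb⟩ ⊗ₜ[ℤ] (⟨morGen C (s.inv ≫ a), trivial⟩ : (⊤ : Submodule ℤ (MorMod C))), rfl⟩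

theorem coprod_equivDiffs (h : DecompositionFinite C) :
    (∀ x ∈ equivDiffs C,
      coprod C x ∈
        LinearMap.range (TensorProduct.map (⊤ : Submodule ℤ (MorMod C)).subtype
            (equivDiffs C).subtype)
        ⊔ LinearMap.range (TensorProduct.map (equivDiffs C).subtype
            (⊤ : Submodule ℤ (MorMod C)).subtype))
    ∧ ∃ Δbar : (MorMod C ⧸ equivDiffs C) →ₗ[ℤ]
          (MorMod C ⧸ equivDiffs C) ⊗[ℤ] (MorMod C ⧸ equivDiffs C),
        ∀ b : MorMod C,
          Δbar (Submodule.Quotient.mk b)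
            = (TensorProduct.map (equivDiffs C).mkQ (equivDiffs C).mkQ) (coprod C b) := by
  refine ⟨coprod_mem C h, (equivDiffs C).liftQ
    ((TensorProduct.map (equivDiffs C).mkQ (equivDiffs C).mkQ) ∘ₗ coprod C) ?_, fun b => rfl⟩
  intro x hx
  change coprod C x ∈ LinearMap.ker (TensorProduct.map (equivDiffs C).mkQ (equivDiffs C).mkQ)
  refine (sup_le ?_ ?_ : _ ≤ LinearMap.ker _) (coprod_mem C h x hx)
  · rw [LinearMap.range_le_ker_iff, ← TensorProduct.map_comp]
    have h0 : (equivDiffs C).mkQ ∘ₗ (equivDiffs C).subtype = 0 := by ext; simp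
    rw [h0, TensorProduct.map_zero_right]
  · rw [LinearMap.range_le_ker_iff, ← TensorProduct.map_comp]
    have h0 : (equivDiffs C).mkQ ∘ₗ (equivDiffs C).subtype = 0 := by ext; simp
    rw [h0, TensorProduct.map_zero_left]
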